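/- Let 𝒱 = (V, {a₀, a₁}) be a primitive 2-generated M(α,1/2)-axial algebra over F with a₀ ≠ a₂, a₁ ≠ a₋₁, a regular axet, and V = V_e. If the even subalgebra (V_e, {a₀, a₂}) is isomorphic as a 2-generated axial algebra to IY₃(α,1/2;μ) for some μ ∈ F, or to the quotient IY₃(−1,1/2;μ)× (when α = −1), or to the quotient IY₃(α,1/2;1)× (when μ = 1), then 𝒱 is symmetric. -/

import Mathlib

namespace AxialFormal

universe u v

variable (F : Type u) [Field F] {V : Type v} [NonUnitalNonAssocCommRing V]
  [Module F V] [SMulCommClass F V V] [IsScalarTower F V V]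

/-- The `μ`-eigenspace of the adjoint map `ad_a : x ↦ a * x`. -/
def eigSp (a : V) (μ : F) : Submodule F V where
  carrier := {w | a * w = μ • w}
  add_mem' := by
    intro x y hx hy
    simp only [Set.mem_setOf_eq] at hx hy ⊢
    rw [mul_add, hx, hy, smul_add]
  zero_mem' := by
    simp only [Set.mem_setOf_eq, mul_zero, smul_zero]
  smul_mem' := by
    intro c x hx
    simp only [Set.mem_setOf_eq] at hx ⊢
    rw [mul_smul_comm, hx, smul_comm]

/-- `a` is a primitive axis of Monster type `(α, β)` in the commutative
(not necessarily associative or unital) `F`-algebra `V`. -/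
structure IsAxis (α β : F) (a : V) : Prop where
  idem : a * a = a
  primitive : eigSp F a 1 = Submodule.span F {a}
  decomp : eigSp F a 1 ⊔ eigSp F a 0 ⊔ eigSp F a α ⊔ eigSp F a β = ⊤
  fusion_one_zero : ∀ u ∈ eigSp F a 1, ∀ w ∈ eigSp F a 0, u * w = 0
  fusion_one_alpha : ∀ u ∈ eigSp F a 1, ∀ w ∈ eigSp F a α, u * w ∈ eigSp F a α
  fusion_one_beta : ∀ u ∈ eigSp F a 1, ∀ w ∈ eigSp F a β, u * w ∈ eigSp F a β
  fusion_zero_zero : ∀ u ∈ eigSp F a 0, ∀ w ∈ eigSp F a 0, u * w ∈ eigSp F a 0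
  fusion_zero_alpha : ∀ u ∈ eigSp F a 0, ∀ w ∈ eigSp F a α, u * w ∈ eigSp F a α
  fusion_zero_beta : ∀ u ∈ eigSp F a 0, ∀ w ∈ eigSp F a β, u * w ∈ eigSp F a β
  fusion_alpha_alpha : ∀ u ∈ eigSp F a α, ∀ w ∈ eigSp F a α,
    u * w ∈ eigSp F a 1 ⊔ eigSp F a 0
  fusion_alpha_beta : ∀ u ∈ eigSp F a α, ∀ w ∈ eigSp F a β, u * w ∈ eigSp F a β
  fusion_beta_beta : ∀ u ∈ eigSp F a β, ∀ w ∈ eigSp F a β,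
    u * w ∈ eigSp F a 1 ⊔ eigSp F a 0 ⊔ eigSp F a α

/-- `(V, {a₀, a₁})` is a primitive 2-generated axial algebra of Monster type `(α, β)`. -/
structure IsTwoGenerated (α β : F) (a₀ a₁ : V) : Prop where
  axis₀ : IsAxis F α β a₀
  axis₁ : IsAxis F α β a₁
  generates : NonUnitalAlgebra.adjoin F {a₀, a₁} = ⊤

/-- `τ` is the Miyamoto involution associated to the axis `a` : it is an algebra
automorphism fixing `V₁ᵃ + V₀ᵃ + Vαᵃ` pointwise and negating `Vβᵃ`. -/
structure IsMiyamoto (α β : F) (a : V) (τ : V ≃ₗ[F] V) : Prop where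
  map_mul : ∀ x y : V, τ (x * y) = τ x * τ y
  fix_plus : ∀ w ∈ eigSp F a 1 ⊔ eigSp F a 0 ⊔ eigSp F a α, τ w = w
  neg_beta : ∀ w ∈ eigSp F a β, τ w = -w

/-- The bi-infinite sequence of axes `a_j`, with `a_{2i} = a₀^{ρ^i}` and
`a_{2i+1} = a₁^{ρ^i}` where `ρ = τ₀τ₁` (as a right action, `v^ρ = τ₁ (τ₀ v)`). -/
def axSeq (a₀ a₁ : V) (τ₀ τ₁ : V ≃ₗ[F] V) (j : ℤ) : V :=
  if j % 2 = 0 then ((τ₁ * τ₀) ^ (j / 2)) a₀ else ((τ₁ * τ₀) ^ ((j - 1) / 2)) a₁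

/-- The orbit of `b` under the Miyamoto group `⟨τ₀, τ₁⟩`. -/
def miyOrbit (τ₀ τ₁ : V ≃ₗ[F] V) (b : V) : Set V :=
  {w | ∃ g ∈ Subgroup.closure ({τ₀, τ₁} : Set (V ≃ₗ[F] V)), g b = w}

/-- The axet of `(V,{a₀,a₁})` is regular: the two orbits have the same cardinality. -/
def HasRegularAxet (a₀ a₁ : V) (τ₀ τ₁ : V ≃ₗ[F] V) : Prop :=
  Nonempty ((miyOrbit F τ₀ τ₁ a₀) ≃ (miyOrbit F τ₀ τ₁ a₁))

/-- The 2-generated axial algebra `(V, {a₀, a₁})` is symmetric: it admits a flip,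
i.e. an algebra automorphism interchanging `a₀` and `a₁`. -/
def IsSymmetric (a₀ a₁ : V) : Prop :=
  ∃ f : V ≃ₗ[F] V, (∀ x y : V, f (x * y) = f x * f y) ∧ f a₀ = a₁ ∧ f a₁ = a₀

/-- `(V,{a₀,a₁})` is isomorphic, as a 2-generated axial algebra, to the algebra on
`Fin n → F` with multiplication `m` and generating axes `g₀, g₁`. -/
def IsoToModel (n : ℕ) (m : (Fin n → F) → (Fin n → F) → Fin n → F)
    (g₀ g₁ : Fin n → F) (a₀ a₁ : V) : Prop :=
  ∃ e : V ≃ₗ[F] (Fin n → F), (∀ x y : V, e (x * y) = m (e x) (e y)) ∧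
    ({e a₀, e a₁} : Set (Fin n → F)) = {g₀, g₁}

/-- `(V,{a₀,a₁})` is isomorphic, as a 2-generated axial algebra, to the quotient of the
algebra on `Fin n → F` with multiplication `m` by the ideal spanned by `K`. -/
def IsoToQuotientModel (n : ℕ) (m : (Fin n → F) → (Fin n → F) → Fin n → F)
    (K : Set (Fin n → F)) (g₀ g₁ : Fin n → F) (a₀ a₁ : V) : Prop :=
  ∃ θ : (Fin n → F) →ₗ[F] V, Function.Surjective θ ∧
    (∀ x y : Fin n → F, θ (m x y) = θ x * θ y) ∧
    LinearMap.ker θ = Submodule.span F K ∧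
    ({θ g₀, θ g₁} : Set V) = {a₀, a₁}

def iyC (α μ : F) : F := (α^2 - α + 1) / 4 * (μ - 1)

def iyD (α : F) : F := (2*α - 1) / 8

def iyG (α : F) : F := (2*α - 1) / 2

def iyP (α μ : F) : F := (2*α - 1) * (α^2 - 3*α + 2) / 16 * (μ - 1)

def iyQc (α μ : F) : F := -((3*α^2 - 5*α + 1) / 4) * (μ - 1)

/-- Structure constants of `IY₃(α, 1/2; μ)` with basis `(b₋₁, b₀, b₁, s)`. -/
def iyT (α μ : F) : Fin 4 → Fin 4 → Fin 4 → F :=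
  ![![![1, 0, 0, 0], ![1/2, 1/2, 0, 1], ![1/2, 0, 1/2, 2*(μ+1)],
      ![iyC F α μ + iyD F α, -2*μ*iyD F α, iyD F α, iyG F α]],
    ![![1/2, 1/2, 0, 1], ![0, 1, 0, 0], ![0, 1/2, 1/2, 1],
      ![iyD F α, iyC F α μ - 2*μ*iyD F α, iyD F α, iyG F α]],
    ![![1/2, 0, 1/2, 2*(μ+1)], ![0, 1/2, 1/2, 1], ![0, 0, 1, 0],
      ![iyD F α, -2*μ*iyD F α, iyC F α μ + iyD F α, iyG F α]],
    ![![iyC F α μ + iyD F α, -2*μ*iyD F α, iyD F α, iyG F α],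
      ![iyD F α, iyC F α μ - 2*μ*iyD F α, iyD F α, iyG F α],
      ![iyD F α, -2*μ*iyD F α, iyC F α μ + iyD F α, iyG F α],
      ![iyP F α μ, -2*μ*iyP F α μ, iyP F α μ, iyQc F α μ]]]

/-- The multiplication of `IY₃(α, 1/2; μ)`; generating axes `b₀ = e₁`, `b₁ = e₂`. -/
def iyMul (α μ : F) (x y : Fin 4 → F) : Fin 4 → F :=
  ∑ i, ∑ j, (x i * y j) • iyT F α μ i j

/-- The element `q = 4s + (1-2α)(b₋₁ + b₁ - 2μb₀)` spanning the ideal defining the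
quotients `IY₃(-1,1/2;μ)×` and `IY₃(α,1/2;1)×`. -/
def iyQvec (α μ : F) : Fin 4 → F :=
  ![1 - 2*α, -2*μ*(1 - 2*α), 1 - 2*α, 4]

theorem aux_eig {α β : F} {a v : V} {l : F} (hA : IsAxis F α β a) (hv : a * v = l • v)
    (h1 : l ≠ 1) (h0 : l ≠ 0) (ha : l ≠ α) (hb : l ≠ β) : v = 0 := by
  have hm : v ∈ eigSp F a 1 ⊔ eigSp F a 0 ⊔ eigSp F a α ⊔ eigSp F a β := by
    rw [hA.decomp]; trivial
  obtain ⟨y, hy, vb, hvb, rfl⟩ := Submodule.mem_sup.1 hm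
  obtain ⟨y', hy', va, hva, rfl⟩ := Submodule.mem_sup.1 hy
  obtain ⟨v1, hv1, v0, hv0, rfl⟩ := Submodule.mem_sup.1 hy'
  change a * v1 = (1:F) • v1 at hv1
  change a * v0 = (0:F) • v0 at hv0
  change a * va = α • va at hva
  change a * vb = β • vb at hvb
  have e1 := hv
  have step : ∀ c d f g : F, a * (c • v1 + d • v0 + f • va + g • vb)
      = c • v1 + (f * α) • va + (g * β) • vb := by
    intro c d f g
    simp only [mul_add, mul_smul_comm, hv1, hv0, hva, hvb]
    module
  have k1 : (1 - l) • v1 + (- l) • v0 + (α - l) • va + (β - l) • vb = 0 := by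
    have := step 1 1 1 1
    simp only [one_smul] at this
    rw [this] at hv
    linear_combination (norm := module) hv
  have k2 := congrArg (fun z => a * z) k1
  simp only [step, mul_zero] at k2
  have hk2 := step (1 - l) 0 ((α - l) * α) ((β - l) * β)
  have e2 : a * ((1 - l) • v1 + (0:F) • v0 + ((α - l) * α) • va + ((β - l) * β) • vb) = 0 := by
    have : (1 - l) • v1 + (0:F) • v0 + ((α - l) * α) • va + ((β - l) * β) • vb = 0 := by
      linear_combination (norm := module) k2
    rw [this, mul_zero]
  rw [step] at e2
  have hk3 : a * ((1 - l) • v1 + (0:F) • v0 + ((α - l) * α * α) • va + ((β - l) * β * β) • vb) = 0 := by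
    have : (1 - l) • v1 + (0:F) • v0 + ((α - l) * α * α) • va + ((β - l) * β * β) • vb = 0 := by
      linear_combination (norm := module) e2
    rw [this, mul_zero]
  rw [step] at hk3
  have hz : ((l - 1) * l * (l - α) * (l - β)) • (v1 + v0 + va + vb) = 0 := by
    linear_combination (norm := module) (-1 : F) • hk3 + (1 + α + β - l) • e2
      + (-(α + β + α * β) + l * (1 + α + β) - l^2) • k2
      + (- (l - 1) * (l - α) * (l - β)) • k1
  rcases smul_eq_zero.1 hz with h | h
  · exfalso
    have := sub_ne_zero.2 h1
    have := sub_ne_zero.2 ha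
    have := sub_ne_zero.2 hb
    simp_all
  · exact h

/-- decomposition into plus part and beta part -/
theorem aux_dec {α β : F} {a : V} (hA : IsAxis F α β a) (v : V) :
    ∃ p ∈ eigSp F a 1 ⊔ eigSp F a 0 ⊔ eigSp F a α, ∃ m ∈ eigSp F a β, p + m = v := by
  have hm : v ∈ eigSp F a 1 ⊔ eigSp F a 0 ⊔ eigSp F a α ⊔ eigSp F a β := by
    rw [hA.decomp]; trivial
  exact Submodule.mem_sup.1 hm

theorem aux_invol {α β : F} {a : V} (hA : IsAxis F α β a) {τ : V ≃ₗ[F] V}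
    (hτ : IsMiyamoto F α β a τ) (v : V) : τ (τ v) = v := by
  obtain ⟨p, hp, m, hm, rfl⟩ := aux_dec F hA v
  simp [hτ.fix_plus p hp, hτ.neg_beta m hm]

theorem aux_fixself {α β : F} {a : V} (hA : IsAxis F α β a) {τ : V ≃ₗ[F] V}
    (hτ : IsMiyamoto F α β a τ) : τ a = a := by
  apply hτ.fix_plus
  apply Submodule.mem_sup_left
  apply Submodule.mem_sup_left
  change a * a = (1:F) • a
  rw [hA.idem, one_smul]

theorem aux_neg {α β : F} (hchar : (2 : F) ≠ 0) {a : V} (hA : IsAxis F α β a) {τ : V ≃ₗ[F] V}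
    (hτ : IsMiyamoto F α β a τ) {v : V} (hv : τ v = - v) : a * v = β • v := by
  obtain ⟨p, hp, m, hm, rfl⟩ := aux_dec F hA v
  rw [map_add, hτ.fix_plus p hp, hτ.neg_beta m hm] at hv
  have : (2:F) • p = 0 := by linear_combination (norm := module) hv
  have hp0 : p = 0 := (smul_eq_zero.1 this).resolve_left hchar
  subst hp0
  rw [zero_add]
  exact hm

/-- the flip -/
theorem core_flip {β δ x y : F} {b0 b1 w s : V} {C D P Q : F}
    (φ0 φ1 : V →ₗ[F] F)
    (hspan : ∀ v, ∃ y t : F, v = φ0 v • b0 + φ1 v • b1 + y • w + t • s)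
    (p00 : φ0 b0 = 1) (p01 : φ0 b1 = 0) (p0w : φ0 w = 0) (p0s : φ0 s = 0)
    (p10 : φ1 b0 = 0) (p11 : φ1 b1 = 1) (p1w : φ1 w = 0) (p1s : φ1 s = 0)
    (hb : 2 * β = 1)
    (m00 : b0 * b0 = b0) (m01 : b0 * b1 = β • (b0 + b1) + s)
    (m0w : b0 * w = δ • b0 + β • w + (2:F) • s)
    (m1w : b1 * w = δ • b1 + β • w + (2:F) • s)
    (m0s : b0 * s = C • b0 + D • w + (4 * D) • s)
    (m1s : b1 * s = C • b1 + D • w + (4 * D) • s)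
    (mww : w * w = (2 * δ) • w + (4 * δ) • s)
    (mws : w * s = C • w + (2 * δ * D) • w + (8 * δ * D) • s)
    (mss : s * s = P • w + Q • s)
    (hx : x ≠ 0) (hxy : x + y * δ = β) {a1 : V} (ha1 : a1 = x • (b0 + b1) + y • w)
    (hi : a1 * a1 = a1) :
    IsSymmetric F b0 a1 := by
  have qs : a1 * s = C • a1 + D • w + (4 * D) • s := by
    rw [ha1]
    simp only [add_mul, smul_mul_assoc, m0s, m1s, mws]
    match_scalars <;> grind
  have qw : a1 * w = δ • a1 + β • w + (2:F) • s := by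
    rw [ha1]
    simp only [add_mul, smul_mul_assoc, m0w, m1w, mww]
    match_scalars <;> grind
  have q0 : b0 * a1 = β • (b0 + a1) + (x + 2 * y) • s := by
    rw [ha1]
    simp only [mul_smul_comm, mul_add, m0w, m00, m01]
    match_scalars <;> grind
  let ψ : V →ₗ[F] F := φ0 - ((1 + x) / x) • φ1
  have r0 : ψ b0 = 1 := by simp [ψ, p00, p10]
  have r1 : ψ a1 = -1 := by
    simp [ψ, ha1, p00, p10, p01, p11, p0w, p1w]; field_simp; ring
  have rw' : ψ w = 0 := by simp [ψ, p0w, p1w]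
  have rs : ψ s = 0 := by simp [ψ, p0s, p1s]
  have hb1 : b1 = x⁻¹ • a1 - b0 - (x⁻¹ * y) • w := by
    rw [ha1]; match_scalars <;> field_simp <;> ring
  have hspan' : ∀ v, ∃ i j k l : F, v = i • b0 + j • a1 + k • w + l • s := by
    intro v
    obtain ⟨k, l, h⟩ := hspan v
    refine ⟨φ0 v - φ1 v, φ1 v * x⁻¹, k - φ1 v * (x⁻¹ * y), l, ?_⟩
    conv_lhs => rw [h, hb1]
    module
  let g : V →ₗ[F] V := LinearMap.id - ψ.smulRight (b0 - a1)
  have gdef : ∀ v, g v = v - ψ v • (b0 - a1) := fun v => by simp [g]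
  have g0 : g b0 = a1 := by rw [gdef, r0]; module
  have g1 : g a1 = b0 := by rw [gdef, r1]; module
  have gw : g w = w := by rw [gdef, rw']; module
  have gs : g s = s := by rw [gdef, rs]; module
  have gg : ∀ v, g (g v) = v := by
    intro v
    obtain ⟨i, j, k, l, rfl⟩ := hspan' v
    simp only [map_add, map_smul, g0, g1, gw, gs]
  have c1 : s * w = w * s := mul_comm _ _
  have c2 : a1 * b0 = b0 * a1 := mul_comm _ _
  have c3 : w * b0 = b0 * w := mul_comm _ _
  have c4 : w * a1 = a1 * w := mul_comm _ _
  have c5 : s * b0 = b0 * s := mul_comm _ _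
  have c6 : s * a1 = a1 * s := mul_comm _ _
  have hss : g (s * s) = s * s := by
    rw [mss, map_add, map_smul, map_smul, gw, gs]
  refine ⟨LinearEquiv.ofLinearMap g g (LinearMap.ext gg) (LinearMap.ext gg), ?_, g0, g1⟩
  intro u v
  change g (u * v) = g u * g v
  obtain ⟨i, j, k, l, rfl⟩ := hspan' u
  obtain ⟨i', j', k', l', rfl⟩ := hspan' v
  simp only [map_add, map_smul, g0, g1, gw, gs, mul_add, add_mul, smul_mul_assoc, mul_smul_comm,
    c1, c2, c3, c4, c5, c6, m00, q0, qs, qw, m0w, m0s, mws, mww, hi, hss]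
  module

theorem core_main {α β δ C D P Q : F}
    (hchar : (2 : F) ≠ 0) (hα0 : α ≠ 0) (hα1 : α ≠ 1) (hb : 2 * β = 1) (hαβ : α ≠ β)
    {b0 b1 w s a1 : V}
    (hA0 : IsAxis F α β b0) (hA1 : IsAxis F α β a1)
    {τ₀ τ₁ : V ≃ₗ[F] V} (hτ₀ : IsMiyamoto F α β b0 τ₀) (hτ₁ : IsMiyamoto F α β a1 τ₁)
    (ht : τ₁ b0 = b1) (hne : τ₀ a1 ≠ a1)
    (φ0 φ1 : V →ₗ[F] F)
    (hspan : ∀ v, ∃ y t : F, v = φ0 v • b0 + φ1 v • b1 + y • w + t • s)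
    (p00 : φ0 b0 = 1) (p01 : φ0 b1 = 0) (p0w : φ0 w = 0) (p0s : φ0 s = 0)
    (p10 : φ1 b0 = 0) (p11 : φ1 b1 = 1) (p1w : φ1 w = 0) (p1s : φ1 s = 0)
    (m11 : b1 * b1 = b1) (m01 : b0 * b1 = β • (b0 + b1) + s)
    (m0w : b0 * w = δ • b0 + β • w + (2:F) • s)
    (m1w : b1 * w = δ • b1 + β • w + (2:F) • s)
    (m0s : b0 * s = C • b0 + D • w + (4 * D) • s)
    (m1s : b1 * s = C • b1 + D • w + (4 * D) • s)
    (mww : w * w = (2 * δ) • w + (4 * δ) • s)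
    (mws : w * s = C • w + (2 * δ * D) • w + (8 * δ * D) • s)
    (mss : s * s = P • w + Q • s)
    (hC : 4 * C = -(α^2 - α + 1) * δ) (hD : 8 * D = 2 * α - 1)
    (hP : 16 * P = - (2 * α - 1) * (α^2 - 3 * α + 2) * δ)
    (hQ : 4 * Q = (3 * α^2 - 5 * α + 1) * δ)
    (hdep : (∀ y t : F, y • w + t • s = 0 → y = 0 ∧ t = 0) ∨
      (s = (2 * D) • w ∧ C = 2 * D * δ)) :
    IsSymmetric F b0 a1 := by
  have m00 := hA0.idem
  have hD0 : D ≠ 0 := by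
    rintro rfl
    apply hαβ
    have : 2 * (α - β) = 0 := by linear_combination -hD - hb
    exact sub_eq_zero.1 ((mul_eq_zero.1 this).resolve_left hchar)
  have c10 : b1 * b0 = b0 * b1 := mul_comm _ _
  have ht' : τ₁ b1 = b0 := by rw [← ht]; exact aux_invol F hA1 hτ₁ b0
  have hts : τ₁ s = s := by
    have hs : s = b0 * b1 - β • (b0 + b1) := by rw [m01]; module
    rw [hs, map_sub, hτ₁.map_mul, map_smul, map_add, ht, ht', c10, add_comm b1 b0]
  have htw : τ₁ w = w := by
    have h := congrArg τ₁ m0s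
    rw [hτ₁.map_mul, map_add, map_add, map_smul, map_smul, map_smul, ht, hts, m1s] at h
    have h2 : D • (τ₁ w - w) = 0 := by linear_combination (norm := module) (-1 : F) • h
    exact sub_eq_zero.1 ((smul_eq_zero.1 h2).resolve_left hD0)
  -- tau0 fixes w, s
  have hk : τ₀ (w + (4:F) • s) = w + (4:F) • s ∧ τ₀ (s - (2 * D) • w) = s - (2 * D) • w := by
    have h0 : τ₀ b0 = b0 := aux_fixself F hA0 hτ₀
    constructor
    · have h1 : τ₀ (w + (4:F) • s + ((δ + 4 * C) / (α - 1)) • b0)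
          = w + (4:F) • s + ((δ + 4 * C) / (α - 1)) • b0 := by
        apply hτ₀.fix_plus
        apply Submodule.mem_sup_right
        change b0 * _ = α • _
        have hα1' : α - 1 ≠ 0 := sub_ne_zero.2 hα1
        simp only [mul_add, mul_smul_comm, m0w, m0s, m00]
        match_scalars
        · field_simp; ring
        · grind
        · grind
      rw [map_add, map_smul _ _ b0, h0] at h1
      exact add_right_cancel h1
    · have h1 : τ₀ (s - (2 * D) • w + (-(C - 2 * D * δ)) • b0)
          = s - (2 * D) • w + (-(C - 2 * D * δ)) • b0 := by
        apply hτ₀.fix_plus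
        apply Submodule.mem_sup_left
        apply Submodule.mem_sup_right
        change b0 * _ = (0:F) • _
        simp only [mul_add, mul_sub, mul_smul_comm, m0w, m0s, m00]
        match_scalars <;> grind
      rw [map_add, map_smul _ _ b0, h0] at h1
      exact add_right_cancel h1
  have h0s : τ₀ s = s := by
    have h1 := hk.1
    have h2 := hk.2
    rw [map_add, map_smul] at h1
    rw [map_sub, map_smul] at h2
    have h3 : (1 + 8 * D) • (τ₀ s - s) = 0 := by
      linear_combination (norm := module) h2 + (2 * D) • h1
    refine sub_eq_zero.1 ((smul_eq_zero.1 h3).resolve_left ?_)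
    rw [hD]
    intro h
    have : 2 * α = 0 := by linear_combination h
    simp_all
  have h0w : τ₀ w = w := by
    have h1 := hk.1
    rw [map_add, map_smul, h0s] at h1
    exact add_right_cancel h1
  -- coordinates of a1
  obtain ⟨y, t, ha1⟩ := hspan a1
  have hta1 := aux_fixself F hA1 hτ₁
  have hx01 : φ0 a1 = φ1 a1 := by
    have h := congrArg τ₁ ha1
    rw [hta1] at h
    simp only [map_add, map_smul, ht, ht', hts, htw] at h
    have h2 := congrArg φ0 h
    simpa [p00, p01, p0w, p0s] using h2
  obtain ⟨x, hxdef⟩ : ∃ x, x = φ0 a1 := ⟨_, rfl⟩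
  rw [← hx01, ← hxdef] at ha1
  have hx : x ≠ 0 := by
    rintro rfl
    apply hne
    rw [ha1]
    simp only [map_add, map_smul, h0w, h0s, zero_smul, map_zero]
  have cw0 : w * b0 = b0 * w := mul_comm _ _
  have cw1 : w * b1 = b1 * w := mul_comm _ _
  have cs0 : s * b0 = b0 * s := mul_comm _ _
  have cs1 : s * b1 = b1 * s := mul_comm _ _
  have csw : s * w = w * s := mul_comm _ _
  have hd : x + y * δ + t * C = β := by
    have h : a1 * (b0 - b1) = β • (b0 - b1) := by
      apply aux_neg F hchar hA1 hτ₁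
      rw [map_sub, ht, ht']; module
    have h2 : a1 * (b0 - b1) = (x + y * δ + t * C) • (b0 - b1) := by
      rw [ha1]
      simp only [mul_sub, add_mul, smul_mul_assoc, cw0, cw1, cs0, cs1, c10, m00, m01, m0w, m1w,
        m0s, m1s, m11]
      module
    rw [h2] at h
    have h3 := congrArg φ0 h
    simpa [p00, p01] using h3
  rcases hdep with hind | ⟨hsw, hCD⟩
  · -- independent
    have hid := hA1.idem
    have hid2 : a1 * a1 = (2 * x * β) • b0 + (2 * x * β) • b1
        + (y + t * (4 * D * (β - t * C) + t * P)) • w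
        + (2 * x^2 + 8 * x * y + 4 * δ * y^2 + 16 * D * t * (β - t * C) + t^2 * Q) • s := by
      rw [ha1]
      simp only [mul_add, add_mul, smul_mul_assoc, mul_smul_comm, cw0, cw1, cs0, cs1, csw, c10,
        m00, m01, m0w, m1w, m0s, m1s, m11, mww, mws, mss]
      match_scalars
      · linear_combination x^2 * hb + 2 * x * hd
      · linear_combination x^2 * hb + 2 * x * hd
      · linear_combination 16 * t * D * hd
      · linear_combination (2 * x * y + y) * hb + (2 * y + 4 * t * D) * hd
    rw [hid] at hid2
    have hz : (t * (4 * D * (β - t * C) + t * P)) • w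
        + (2 * x^2 + 8 * x * y + 4 * δ * y^2 + 16 * D * t * (β - t * C) + t^2 * Q - t) • s = 0 := by
      have e1 : 2 * x * β = x := by linear_combination x * hb
      rw [e1] at hid2
      linear_combination (norm := module) ha1 - hid2
    obtain ⟨hw0, hs0⟩ := hind _ _ hz
    have ht0 : t = 0 := by
      by_contra htn
      have h1 := (mul_eq_zero.1 hw0).resolve_left htn
      have h2 : 2 * 2 * 2 * D * (4 + t * δ * α * (α + 1)) = 0 := by
        linear_combination 16 * h1 - 32 * D * hb + 16 * D * t * hC - t * hP
          - t * δ * (α^2 - 3 * α + 2) * hD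
      have h2D : 2 * 2 * 2 * D ≠ 0 := by simp [hchar, hD0]
      have h3 := (mul_eq_zero.1 h2).resolve_left h2D
      have h4 : (4:F) ≠ 0 := by
        have h22 : (4:F) = 2 * 2 := by norm_num
        rw [h22]; exact mul_ne_zero hchar hchar
      have hv : a1 * ((4:F) • a1 + t • ((α - 2) • w - (4 * (α + 2)) • s))
          = (1 - α) • ((4:F) • a1 + t • ((α - 2) • w - (4 * (α + 2)) • s)) := by
        rw [mul_add, mul_smul_comm, hid, ha1]
        simp only [mul_sub, add_mul, smul_mul_assoc, mul_smul_comm, cw0, cw1, cs0, cs1, csw, c10,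
          m00, m01, m0w, m1w, m0s, m1s, m11, mww, mws, mss]
        match_scalars
        · linear_combination α * x * h3 - t * x * (α + 2) * hC
        · linear_combination α * x * h3 - t * x * (α + 2) * hC
        · apply mul_left_cancel₀ h4
          linear_combination (4 * t * (α - 2) * x + 2 * t * (α - 2) - 16 * t * D * (α + 2)) * hb
            + (4 * t * (α - 2) - 32 * t * D * (α + 2)) * hd
            + (- 4 * t * (α + 2) * y + 8 * t^2 * (α + 2) * D) * hC - t^2 * (α + 2) * hP
            + (-2 * t * (α + 2) + t^2 * (α - 2) * δ - t^2 * (α + 2) * δ * (α^2 - α + 1)) * hD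
            + (4 * α * y - 2 * t * (2 * α - 1)) * h3
        · linear_combination (4 * t * (α - 2) - 32 * t * (α + 2) * D) * hd
            + (2 * t * (α - 2) - 16 * t * (α + 2) * D) * hb
            + (- t^2 * (α - 2) + 8 * t^2 * (α + 2) * D) * hC - t^2 * (α + 2) * hQ
            + (-2 * t * (α + 2) + t^2 * (α - 2) * δ - t^2 * (α + 2) * δ * (α^2 - α + 1)) * hD
            + t * (-2 * α^2 - α + 2) * h3
      have hv0 := aux_eig F hA1 hv (by simpa using hα0) (by rw [sub_ne_zero]; exact hα1.symm)
        (by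
          intro h
          apply hαβ
          have : 2 * (α - β) = 0 := by linear_combination -h - hb
          exact sub_eq_zero.1 ((mul_eq_zero.1 this).resolve_left hchar))
        (by
          intro h
          apply hαβ
          linear_combination -h - hb)
      have h5 := congrArg φ0 hv0
      simp only [map_add, map_smul, map_sub, p0w, p0s, ← hxdef, smul_eq_mul, mul_zero, sub_zero,
        add_zero, map_zero] at h5
      exact mul_ne_zero h4 hx h5
    subst ht0
    refine core_flip F φ0 φ1 hspan p00 p01 p0w p0s p10 p11 p1w p1s hb m00 m01 m0w m1w m0s m1s mww
      mws mss hx (y := y) ?_ ?_ hid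
    · linear_combination hd
    · rw [ha1]; module
  · refine core_flip F φ0 φ1 hspan p00 p01 p0w p0s p10 p11 p1w p1s hb m00 m01 m0w m1w m0s m1s mww
      mws mss hx (y := y + t * (2 * D)) ?_ ?_ hA1.idem
    · rw [hCD] at hd
      linear_combination hd
    · rw [ha1, hsw]; module

def vB0 : Fin 4 → F := ![0, 1, 0, 0]

def vB1 : Fin 4 → F := ![0, 0, 1, 0]

def vS : Fin 4 → F := ![0, 0, 0, 1]

def vW (μ : F) : Fin 4 → F := ![1, -2 * μ, 1, 0]

theorem iyMul_eq (α μ : F) (x y : Fin 4 → F) : iyMul F α μ x y =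
    ![x 0 * y 0 + (x 0 * y 1 + x 1 * y 0) * (1/2) + (x 0 * y 2 + x 2 * y 0) * (1/2)
        + (x 0 * y 3 + x 3 * y 0) * (iyC F α μ + iyD F α)
        + (x 1 * y 3 + x 3 * y 1) * iyD F α + (x 2 * y 3 + x 3 * y 2) * iyD F α
        + x 3 * y 3 * iyP F α μ,
      x 1 * y 1 + (x 0 * y 1 + x 1 * y 0) * (1/2) + (x 1 * y 2 + x 2 * y 1) * (1/2)
        + (x 0 * y 3 + x 3 * y 0) * (-2*μ*iyD F α)
        + (x 1 * y 3 + x 3 * y 1) * (iyC F α μ -2*μ*iyD F α)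
        + (x 2 * y 3 + x 3 * y 2) * (-2*μ*iyD F α)
        + x 3 * y 3 * (-2*μ*iyP F α μ),
      x 2 * y 2 + (x 0 * y 2 + x 2 * y 0) * (1/2) + (x 1 * y 2 + x 2 * y 1) * (1/2)
        + (x 0 * y 3 + x 3 * y 0) * iyD F α
        + (x 1 * y 3 + x 3 * y 1) * iyD F α + (x 2 * y 3 + x 3 * y 2) * (iyC F α μ + iyD F α)
        + x 3 * y 3 * iyP F α μ,
      (x 0 * y 1 + x 1 * y 0) + (x 1 * y 2 + x 2 * y 1) + (x 0 * y 2 + x 2 * y 0) * (2*(μ+1))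
        + (x 0 * y 3 + x 3 * y 0 + x 1 * y 3 + x 3 * y 1 + x 2 * y 3 + x 3 * y 2) * iyG F α
        + x 3 * y 3 * iyQc F α μ] := by
  funext i
  fin_cases i <;> simp [iyMul, iyT, Fin.sum_univ_four] <;> ring

theorem theta_main {α β μ : F}
    (hchar : (2 : F) ≠ 0) (hα0 : α ≠ 0) (hα1 : α ≠ 1) (hb : 2 * β = 1) (hαβ : α ≠ β)
    {a0 a1 : V}
    (hA0 : IsAxis F α β a0) (hA1 : IsAxis F α β a1)
    {τ₀ τ₁ : V ≃ₗ[F] V} (hτ₀ : IsMiyamoto F α β a0 τ₀) (hτ₁ : IsMiyamoto F α β a1 τ₁)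
    (hne : τ₀ a1 ≠ a1) (hne' : a0 ≠ τ₁ a0)
    (θ : (Fin 4 → F) →ₗ[F] V) (hsurj : Function.Surjective θ)
    (hmul : ∀ x y, θ (iyMul F α μ x y) = θ x * θ y)
    (hker : LinearMap.ker θ = ⊥ ∨
      (LinearMap.ker θ = Submodule.span F {iyQvec F α μ} ∧ (α = -1 ∨ μ = 1)))
    (hset : ({θ (Pi.single 1 1), θ (Pi.single 2 1)} : Set V) = {a0, τ₁ a0}) :
    IsSymmetric F a0 a1 := by
  have h4 : (4:F) ≠ 0 := by
    have h22 : (4:F) = 2 * 2 := by norm_num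
    rw [h22]; exact mul_ne_zero hchar hchar
  have h8 : (8:F) ≠ 0 := by
    have h22 : (8:F) = 2 * 4 := by norm_num
    rw [h22]; exact mul_ne_zero hchar h4
  have h16 : (16:F) ≠ 0 := by
    have h22 : (16:F) = 4 * 4 := by norm_num
    rw [h22]; exact mul_ne_zero h4 h4
  have hβ : β = 1 / 2 := by field_simp; linear_combination hb
  have e1 : (Pi.single 1 1 : Fin 4 → F) = vB0 F := by
    funext i; fin_cases i <;> simp [vB0]
  have e2 : (Pi.single 2 1 : Fin 4 → F) = vB1 F := by
    funext i; fin_cases i <;> simp [vB1]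
  rw [e1, e2] at hset
  have v00 : iyMul F α μ (vB0 F) (vB0 F) = vB0 F := by
    rw [iyMul_eq]; funext i; fin_cases i <;> simp [vB0]
  have v11 : iyMul F α μ (vB1 F) (vB1 F) = vB1 F := by
    rw [iyMul_eq]; funext i; fin_cases i <;> simp [vB1]
  have v01 : iyMul F α μ (vB0 F) (vB1 F) = β • (vB0 F + vB1 F) + vS F := by
    rw [iyMul_eq, hβ]; funext i; fin_cases i <;> simp [vB0, vB1, vS]
  have v0w : iyMul F α μ (vB0 F) (vW F μ) = (1 - μ) • vB0 F + β • vW F μ + (2:F) • vS F := by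
    rw [iyMul_eq, hβ]; funext i; fin_cases i <;> simp [vB0, vB1, vS, vW] <;> field_simp <;> ring
  have v1w : iyMul F α μ (vB1 F) (vW F μ) = (1 - μ) • vB1 F + β • vW F μ + (2:F) • vS F := by
    rw [iyMul_eq, hβ]; funext i; fin_cases i <;> simp [vB0, vB1, vS, vW] <;> field_simp <;> ring
  have hG : iyG F α = 4 * iyD F α := by simp only [iyG, iyD]; field_simp; ring
  have v0s : iyMul F α μ (vB0 F) (vS F) =
      iyC F α μ • vB0 F + iyD F α • vW F μ + (4 * iyD F α) • vS F := by
    rw [iyMul_eq, hG]; funext i; fin_cases i <;> simp [vB0, vB1, vS, vW] <;> ring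
  have v1s : iyMul F α μ (vB1 F) (vS F) =
      iyC F α μ • vB1 F + iyD F α • vW F μ + (4 * iyD F α) • vS F := by
    rw [iyMul_eq, hG]; funext i; fin_cases i <;> simp [vB0, vB1, vS, vW] <;> ring
  have vww : iyMul F α μ (vW F μ) (vW F μ) =
      (2 * (1 - μ)) • vW F μ + (4 * (1 - μ)) • vS F := by
    rw [iyMul_eq]; funext i; fin_cases i <;> simp [vB0, vB1, vS, vW] <;> field_simp <;> ring
  have vws : iyMul F α μ (vW F μ) (vS F) =
      iyC F α μ • vW F μ + (2 * (1 - μ) * iyD F α) • vW F μ + (8 * (1 - μ) * iyD F α) • vS F := by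
    rw [iyMul_eq, hG]; funext i; fin_cases i <;> simp [vB0, vB1, vS, vW] <;> ring
  have vss : iyMul F α μ (vS F) (vS F) = iyP F α μ • vW F μ + iyQc F α μ • vS F := by
    rw [iyMul_eq]; funext i; fin_cases i <;> simp [vB0, vB1, vS, vW] <;> ring
  -- functionals
  obtain ⟨σ, hσ⟩ := θ.exists_rightInverse_of_surjective (LinearMap.range_eq_top.2 hsurj)
  have hσ' : ∀ v, θ (σ v) = v := fun v => by
    have := LinearMap.congr_fun hσ v
    simpa using this
  let ψ0 : (Fin 4 → F) →ₗ[F] F := (LinearMap.proj 1 : (Fin 4 → F) →ₗ[F] F) + (2 * μ) • (LinearMap.proj 0 : (Fin 4 → F) →ₗ[F] F)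
  let ψ1 : (Fin 4 → F) →ₗ[F] F := (LinearMap.proj 2 : (Fin 4 → F) →ₗ[F] F) - (LinearMap.proj 0 : (Fin 4 → F) →ₗ[F] F)
  have ψ0def : ∀ x, ψ0 x = x 1 + 2 * μ * x 0 := fun x => by simp [ψ0]
  have ψ1def : ∀ x, ψ1 x = x 2 - x 0 := fun x => by simp [ψ1]
  have hkerψ : ∀ x, θ x = 0 → ψ0 x = 0 ∧ ψ1 x = 0 := by
    intro x hx
    have hx' : x ∈ LinearMap.ker θ := hx
    rcases hker with h | ⟨h, -⟩
    · rw [h, Submodule.mem_bot] at hx'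
      subst hx'
      simp
    · rw [h, Submodule.mem_span_singleton] at hx'
      obtain ⟨c, rfl⟩ := hx'
      rw [ψ0def, ψ1def]
      simp [iyQvec]
      ring
  have hσθ : ∀ x, ψ0 (σ (θ x)) = ψ0 x ∧ ψ1 (σ (θ x)) = ψ1 x := by
    intro x
    have h := hkerψ (σ (θ x) - x) (by rw [map_sub, hσ', sub_self])
    rw [map_sub, map_sub] at h
    exact ⟨sub_eq_zero.1 h.1, sub_eq_zero.1 h.2⟩
  have hspan : ∀ v, ∃ y t : F, v = (ψ0 ∘ₗ σ) v • θ (vB0 F) + (ψ1 ∘ₗ σ) v • θ (vB1 F)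
      + y • θ (vW F μ) + t • θ (vS F) := by
    intro v
    refine ⟨σ v 0, σ v 3, ?_⟩
    conv_lhs => rw [← hσ' v]
    simp only [← map_smul, ← map_add, LinearMap.comp_apply]
    congr 1
    funext i
    fin_cases i <;> simp [vB0, vB1, vW, vS, ψ0def, ψ1def] <;> ring
  have hspan' : ∀ v, ∃ y t : F, v = (ψ1 ∘ₗ σ) v • θ (vB1 F) + (ψ0 ∘ₗ σ) v • θ (vB0 F)
      + y • θ (vW F μ) + t • θ (vS F) := by
    intro v
    obtain ⟨y, t, h⟩ := hspan v
    refine ⟨y, t, ?_⟩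
    rw [add_comm (_ • θ (vB1 F))]
    exact h
  have hφ0 : ∀ x, (ψ0 ∘ₗ σ) (θ x) = ψ0 x := fun x => (hσθ x).1
  have hφ1 : ∀ x, (ψ1 ∘ₗ σ) (θ x) = ψ1 x := fun x => (hσθ x).2
  have p00 : (ψ0 ∘ₗ σ) (θ (vB0 F)) = 1 := by rw [hφ0, ψ0def]; simp [vB0]
  have p01 : (ψ0 ∘ₗ σ) (θ (vB1 F)) = 0 := by rw [hφ0, ψ0def]; simp [vB1]
  have p0w : (ψ0 ∘ₗ σ) (θ (vW F μ)) = 0 := by rw [hφ0, ψ0def]; simp [vW]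
  have p0s : (ψ0 ∘ₗ σ) (θ (vS F)) = 0 := by rw [hφ0, ψ0def]; simp [vS]
  have p10 : (ψ1 ∘ₗ σ) (θ (vB0 F)) = 0 := by rw [hφ1, ψ1def]; simp [vB0]
  have p11 : (ψ1 ∘ₗ σ) (θ (vB1 F)) = 1 := by rw [hφ1, ψ1def]; simp [vB1]
  have p1w : (ψ1 ∘ₗ σ) (θ (vW F μ)) = 0 := by rw [hφ1, ψ1def]; simp [vW]
  have p1s : (ψ1 ∘ₗ σ) (θ (vS F)) = 0 := by rw [hφ1, ψ1def]; simp [vS]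
  have m00 := (hmul _ _).symm.trans (congrArg θ v00)
  have m11 := (hmul _ _).symm.trans (congrArg θ v11)
  have m01 := (hmul _ _).symm.trans (congrArg θ v01)
  have m0w := (hmul _ _).symm.trans (congrArg θ v0w)
  have m1w := (hmul _ _).symm.trans (congrArg θ v1w)
  have m0s := (hmul _ _).symm.trans (congrArg θ v0s)
  have m1s := (hmul _ _).symm.trans (congrArg θ v1s)
  have mww := (hmul _ _).symm.trans (congrArg θ vww)
  have mws := (hmul _ _).symm.trans (congrArg θ vws)
  have mss := (hmul _ _).symm.trans (congrArg θ vss)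
  simp only [map_add, map_smul] at m01 m0w m1w m0s m1s mww mws mss
  have m10 : θ (vB1 F) * θ (vB0 F) = β • (θ (vB1 F) + θ (vB0 F)) + θ (vS F) := by
    rw [mul_comm, m01, add_comm (θ (vB0 F))]
  have hC : 4 * iyC F α μ = -(α^2 - α + 1) * (1 - μ) := by
    simp only [iyC]; field_simp; ring
  have hD : 8 * iyD F α = 2 * α - 1 := by
    simp only [iyD]; field_simp
  have hP : 16 * iyP F α μ = - (2 * α - 1) * (α^2 - 3 * α + 2) * (1 - μ) := by
    simp only [iyP]; field_simp; ring
  have hQ : 4 * iyQc F α μ = (3 * α^2 - 5 * α + 1) * (1 - μ) := by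
    simp only [iyQc]; field_simp; ring
  have hdep : (∀ y t : F, y • θ (vW F μ) + t • θ (vS F) = 0 → y = 0 ∧ t = 0) ∨
      (θ (vS F) = (2 * iyD F α) • θ (vW F μ) ∧ iyC F α μ = 2 * iyD F α * (1 - μ)) := by
    rcases hker with h | ⟨h, h'⟩
    · left
      intro y t hyt
      have hm : y • vW F μ + t • vS F ∈ LinearMap.ker θ := by
        rw [LinearMap.mem_ker, map_add, map_smul, map_smul, hyt]
      rw [h, Submodule.mem_bot] at hm
      have k0 := congrFun hm 0
      have k3 := congrFun hm 3
      simp [vW, vS] at k0 k3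
      exact ⟨k0, k3⟩
    · right
      constructor
      · have hm : iyQvec F α μ ∈ LinearMap.ker θ := by
          rw [h]; exact Submodule.mem_span_singleton_self _
        have hq : iyQvec F α μ = (4:F) • (vS F - (2 * iyD F α) • vW F μ) := by
          funext i
          fin_cases i <;> simp [iyQvec, vS, vW]
          · linear_combination hD
          · linear_combination -2 * μ * hD
          · linear_combination hD
        rw [hq, LinearMap.mem_ker, map_smul] at hm
        have := (smul_eq_zero.1 hm).resolve_left h4
        rw [map_sub, map_smul] at this
        exact sub_eq_zero.1 this
      · apply mul_left_cancel₀ h4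
        rcases h' with rfl | rfl
        · linear_combination hC - (1 - μ) * hD
        · linear_combination hC
  have hcase : (a0 = θ (vB0 F) ∧ τ₁ a0 = θ (vB1 F)) ∨ (a0 = θ (vB1 F) ∧ τ₁ a0 = θ (vB0 F)) := by
    have q1 : a0 ∈ ({θ (vB0 F), θ (vB1 F)} : Set V) := by rw [hset]; simp
    have q2 : τ₁ a0 ∈ ({θ (vB0 F), θ (vB1 F)} : Set V) := by rw [hset]; simp
    simp only [Set.mem_insert_iff, Set.mem_singleton_iff] at q1 q2
    rcases q1 with q1 | q1 <;> rcases q2 with q2 | q2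
    · exact absurd (q1.trans q2.symm) hne'
    · exact Or.inl ⟨q1, q2⟩
    · exact Or.inr ⟨q1, q2⟩
    · exact absurd (q1.trans q2.symm) hne'
  rcases hcase with ⟨h0, h1⟩ | ⟨h0, h1⟩
  · subst h0
    exact core_main F hchar hα0 hα1 hb hαβ hA0 hA1 hτ₀ hτ₁ h1 hne (ψ0 ∘ₗ σ) (ψ1 ∘ₗ σ) hspan
      p00 p01 p0w p0s p10 p11 p1w p1s m11 m01 m0w m1w m0s m1s mww mws mss hC hD hP hQ hdep
  · subst h0
    exact core_main F hchar hα0 hα1 hb hαβ hA0 hA1 hτ₀ hτ₁ h1 hne (ψ1 ∘ₗ σ) (ψ0 ∘ₗ σ) hspan'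
      p11 p10 p1w p1s p01 p00 p0w p0s m00 m10 m1w m0w m1s m0s mww mws mss hC hD hP hQ hdep

/-- If the even subalgebra `V_e = V` is isomorphic (as a 2-generated axial algebra)
to `IY₃(α,1/2;μ)` or to one of its quotients `IY₃(-1,1/2;μ)×`, `IY₃(α,1/2;1)×`, then
`(V,{a₀,a₁})` is symmetric. -/
theorem even_IY3_symmetric {α β : F}
    (hchar : (2 : F) ≠ 0)
    (hα0 : α ≠ 0) (hα1 : α ≠ 1) (hβ : β = 1 / 2) (hαβ : α ≠ β)
    {a₀ a₁ : V} (hV : IsTwoGenerated F α β a₀ a₁)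
    (τ₀ τ₁ : V ≃ₗ[F] V) (hτ₀ : IsMiyamoto F α β a₀ τ₀) (hτ₁ : IsMiyamoto F α β a₁ τ₁)
    (a : ℤ → V) (ha : a = axSeq F a₀ a₁ τ₀ τ₁)
    (hne02 : a 0 ≠ a 2) (hne1 : a 1 ≠ a (-1))
    (hreg : HasRegularAxet F a₀ a₁ τ₀ τ₁)
    (hVe : NonUnitalAlgebra.adjoin F ({a 0, a 2} : Set V) = ⊤)
    (hiso :
      (∃ μ : F, IsoToModel F 4 (iyMul F α μ)
        (Pi.single 1 1) (Pi.single 2 1) (a 0) (a 2)) ∨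
      (α = -1 ∧ ∃ μ : F, IsoToQuotientModel F 4 (iyMul F α μ) {iyQvec F α μ}
        (Pi.single 1 1) (Pi.single 2 1) (a 0) (a 2)) ∨
      (IsoToQuotientModel F 4 (iyMul F α 1) {iyQvec F α 1}
        (Pi.single 1 1) (Pi.single 2 1) (a 0) (a 2))) :
    IsSymmetric F a₀ a₁ := by
  have hb : 2 * β = 1 := by rw [hβ]; field_simp
  have i0 := aux_invol F hV.axis₀ hτ₀
  have i1 := aux_invol F hV.axis₁ hτ₁
  have f0 := aux_fixself F hV.axis₀ hτ₀
  have f1 := aux_fixself F hV.axis₁ hτ₁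
  have s0 : a 0 = a₀ := by rw [ha]; simp [axSeq]
  have s1 : a 1 = a₁ := by rw [ha]; simp [axSeq]
  have s2 : a 2 = τ₁ a₀ := by rw [ha]; simp [axSeq, f0]
  have sm : τ₁ (τ₀ (a (-1))) = a₁ := by
    have h : a (-1) = ((τ₁ * τ₀) ^ (-1 : ℤ)) a₁ := by rw [ha]; simp [axSeq]
    have h2 : (τ₁ * τ₀) (((τ₁ * τ₀) ^ (-1 : ℤ)) a₁) = a₁ := by
      rw [← LinearEquiv.mul_apply, zpow_neg_one, mul_inv_cancel]; rfl
    rw [← h] at h2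
    exact h2
  have hne : τ₀ a₁ ≠ a₁ := by
    intro h
    apply hne1
    rw [s1]
    have h1 := congrArg τ₁ sm
    rw [i1, f1] at h1
    have h2 := congrArg τ₀ h1
    rw [i0, h] at h2
    exact h2.symm
  have hne' : a₀ ≠ τ₁ a₀ := by rw [← s2, ← s0]; exact hne02
  rw [s0, s2] at hiso
  rcases hiso with ⟨μ, e, hmul, hset⟩ | ⟨hα, μ, θ, hsurj, hmul, hker, hset⟩ |
      ⟨θ, hsurj, hmul, hker, hset⟩
  · refine theta_main F (μ := μ) hchar hα0 hα1 hb hαβ hV.axis₀ hV.axis₁ hτ₀ hτ₁ hne hne'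
      (e.symm : (Fin 4 → F) →ₗ[F] V) e.symm.surjective ?_ (Or.inl ?_) ?_
    · intro x y
      apply e.injective
      simp [hmul]
    · exact LinearEquiv.ker e.symm
    · have h := congrArg (fun S => e.symm '' S) hset
      simp only [Set.image_pair, LinearEquiv.symm_apply_apply] at h
      exact h.symm
  · exact theta_main F (μ := μ) hchar hα0 hα1 hb hαβ hV.axis₀ hV.axis₁ hτ₀ hτ₁ hne hne'
      θ hsurj hmul (Or.inr ⟨hker, Or.inl hα⟩) hset
  · exact theta_main F (μ := 1) hchar hα0 hα1 hb hαβ hV.axis₀ hV.axis₁ hτ₀ hτ₁ hne hne'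
      θ hsurj hmul (Or.inr ⟨hker, Or.inr rfl⟩) hset

end AxialFormal
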